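/- Let M ∈ ℝ^{n×n} be an upper Hessenberg P-matrix and q ∈ ℝⁿ such that LCP(M,q) is nondegenerate. For k ∈ {0,1,…,n}, let K_k := {n−k+1, …, n} and let B'(k) ⊆ K_k denote the unique optimal basis of LCP(M_{K_k K_k}, q_{K_k}), with B'(−1) = B'(0) = ∅. Then for every k ∈ [n] there exists an index ℓ ∈ {−1, 0, …, k−1} such that B'(k) = B'(ℓ) ∪ {n−k+1, n−k+2, …, n−ℓ−1}. -/

import Mathlib

open Matrix

/-- The basis matrix `M̄_B`: column `j` is the `j`-th column of `-M` if `j ∈ B`,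
and the `j`-th column of the identity matrix otherwise. -/
def basisMatrix {ι : Type*} [Fintype ι] [DecidableEq ι]
    (M : Matrix ι ι ℝ) (B : Finset ι) : Matrix ι ι ℝ :=
  fun i j => if j ∈ B then -M i j else if i = j then 1 else 0

/-- A P-matrix: every principal minor is positive. -/
def IsPMatrix {ι : Type*} [Fintype ι] [DecidableEq ι] (M : Matrix ι ι ℝ) : Prop :=
  ∀ K : Finset ι, 0 < (M.submatrix (fun i : K => i.1) (fun j : K => j.1)).det

/-- The vector `w(B)` of the complementary pair. -/
noncomputable def wvec {ι : Type*} [Fintype ι] [DecidableEq ι]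
    (M : Matrix ι ι ℝ) (q : ι → ℝ) (B : Finset ι) : ι → ℝ :=
  fun i => if i ∈ B then 0 else ((basisMatrix M B)⁻¹ *ᵥ q) i

/-- The vector `z(B)` of the complementary pair. -/
noncomputable def zvec {ι : Type*} [Fintype ι] [DecidableEq ι]
    (M : Matrix ι ι ℝ) (q : ι → ℝ) (B : Finset ι) : ι → ℝ :=
  fun i => if i ∈ B then ((basisMatrix M B)⁻¹ *ᵥ q) i else 0

/-- `(w, z)` solves the linear complementarity problem LCP(M,q). -/
def SolvesLCP {ι : Type*} [Fintype ι] (M : Matrix ι ι ℝ) (q w z : ι → ℝ) : Prop :=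
  w - M *ᵥ z = q ∧ (∀ i, 0 ≤ w i) ∧ (∀ i, 0 ≤ z i) ∧ w ⬝ᵥ z = 0

/-- `B` is an optimal basis for LCP(M,q). -/
noncomputable def OptimalBasis {ι : Type*} [Fintype ι] [DecidableEq ι]
    (M : Matrix ι ι ℝ) (q : ι → ℝ) (B : Finset ι) : Prop :=
  SolvesLCP M q (wvec M q B) (zvec M q B)

/-- LCP(M,q) is nondegenerate. -/
def Nondeg {ι : Type*} [Fintype ι] [DecidableEq ι] (M : Matrix ι ι ℝ) (q : ι → ℝ) : Prop :=
  ∀ B : Finset ι, ∀ i, ((basisMatrix M B)⁻¹ *ᵥ q) i ≠ 0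

/-- `M` is lower Hessenberg: `m_{ij} = 0` whenever `j - i > 1`. -/
def LowerHessenberg {k : ℕ} (M : Matrix (Fin k) (Fin k) ℝ) : Prop :=
  ∀ i j : Fin k, (i : ℕ) + 1 < (j : ℕ) → M i j = 0

/-- `M` is upper Hessenberg: `m_{ij} = 0` whenever `i - j > 1`. -/
def UpperHessenberg {k : ℕ} (M : Matrix (Fin k) (Fin k) ℝ) : Prop :=
  ∀ i j : Fin k, (j : ℕ) + 1 < (i : ℕ) → M i j = 0

/-- The increasing enumeration of the last `k` indices
`K_k = {n-k+1, …, n}` (1-based), i.e. 0-based `{n-k, …, n-1}`. -/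
def lastEmb (n k : ℕ) (hk : k ≤ n) : Fin k → Fin n :=
  fun i => ⟨n - k + i.val, by have := i.isLt; omega⟩

/-- Restricting a solution of an LCP to a block of rows that the remaining part of the solution
does not influence. -/
theorem SolvesLCP.submatrix {ι κ : Type*} [Fintype ι] [Fintype κ] {M : Matrix ι ι ℝ} {q w z : ι → ℝ}
    (h : SolvesLCP M q w z) (e : κ ↪ ι) (he : ∀ i j, j ∉ Set.range e → M (e i) j * z j = 0) :
    SolvesLCP (M.submatrix e e) (q ∘ e) (w ∘ e) (z ∘ e) := by
  obtain ⟨heq, hw, hz, hwz⟩ := h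
  have hc := (Finset.sum_eq_zero_iff_of_nonneg (fun i _ => mul_nonneg (hw i) (hz i))).1 hwz
  refine ⟨?_, fun i => hw _, fun i => hz _,
    Finset.sum_eq_zero fun i _ => hc (e i) (Finset.mem_univ _)⟩
  funext i
  have h₁ : (M *ᵥ z) (e i) = (M.submatrix e e *ᵥ (z ∘ e)) i :=
    (Fintype.sum_of_injective e e.injective _ _ (he i) fun _ => rfl).symm
  have h₂ := congrFun heq (e i)
  simp only [Pi.sub_apply, Function.comp_apply] at h₂ ⊢
  rw [← h₁, h₂]

section PMatrix

variable {ι κ : Type*} [Fintype ι] [DecidableEq ι] [Fintype κ] [DecidableEq κ]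

theorem IsPMatrix.submatrix {M : Matrix ι ι ℝ} (hM : IsPMatrix M) (e : κ ↪ ι) :
    IsPMatrix (M.submatrix e e) := by
  intro K
  have h := hM (K.map e)
  rw [← Matrix.det_submatrix_equiv_self (K.equivMap e)] at h
  exact h

/-- The matrix `M + diagonal d` with the rows outside `K` replaced by those of the identity. -/
def shiftedRows (M : Matrix ι ι ℝ) (K : Finset ι) (d : ι → ℝ) : Matrix ι ι ℝ :=
  fun i => if i ∈ K then M i + d i • Pi.single i 1 else Pi.single i 1

theorem det_shiftedRows_zero (M : Matrix ι ι ℝ) (K : Finset ι) :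
    (shiftedRows M K 0).det = (M.submatrix (fun i : K => i.1) (fun j : K => j.1)).det := by
  rw [Matrix.twoBlockTriangular_det _ (fun i => i ∈ K)]
  · have h₁ : (shiftedRows M K 0).toSquareBlockProp (fun i => i ∈ K) =
        M.submatrix (fun i : K => i.1) (fun j : K => j.1) := by
      ext i j
      have hi : (i : ι) ∈ K := i.2
      simp [Matrix.toSquareBlockProp, shiftedRows, hi]
    have h₂ : (shiftedRows M K 0).toSquareBlockProp (fun i => i ∉ K) = 1 := by
      ext i j
      have hi : (i : ι) ∉ K := i.2
      simp [Matrix.toSquareBlockProp, shiftedRows, hi, Pi.single_apply, Matrix.one_apply,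
        Subtype.ext_iff, eq_comm]
    rw [h₁, h₂, Matrix.det_one, mul_one]
    congr!
  · intro i hi j hj
    have hij : j ≠ i := by rintro rfl; exact hi hj
    simp [shiftedRows, hi, hij]

theorem IsPMatrix.det_shiftedRows_pos {M : Matrix ι ι ℝ} (hM : IsPMatrix M) {d : ι → ℝ}
    (hd : ∀ i, 0 ≤ d i) (K : Finset ι) : 0 < (shiftedRows M K d).det := by
  suffices h : ∀ (S K : Finset ι),
      0 < (shiftedRows M K (fun i => if i ∈ S then d i else 0)).det by
    simpa using h Finset.univ K
  intro S
  induction S using Finset.induction_on with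
  | empty =>
    intro K
    have h := hM K
    rw [← det_shiftedRows_zero] at h
    simpa [Pi.zero_def] using h
  | insert a S ha ih =>
    intro K
    by_cases haK : a ∈ K
    · set N := shiftedRows M K (fun i => if i ∈ S then d i else 0) with hN
      have h₁ : shiftedRows M K (fun i => if i ∈ insert a S then d i else 0) =
          N.updateRow a (N a + d a • Pi.single a 1) := by
        ext i j
        by_cases hi : i = a
        · subst hi
          simp [hN, shiftedRows, haK, ha]
        · simp [hN, shiftedRows, hi]
      have h₂ : N.updateRow a (Pi.single a 1) =
          shiftedRows M (K.erase a) (fun i => if i ∈ S then d i else 0) := by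
        ext i j
        by_cases hi : i = a
        · subst hi
          simp [shiftedRows]
        · simp [hN, shiftedRows, hi]
      rw [h₁, Matrix.det_updateRow_add, Matrix.det_updateRow_smul, Matrix.updateRow_eq_self, h₂]
      exact add_pos_of_pos_of_nonneg (ih K) (mul_nonneg (hd a) (ih _).le)
    · have h : shiftedRows M K (fun i => if i ∈ insert a S then d i else 0) =
          shiftedRows M K (fun i => if i ∈ S then d i else 0) := by
        funext i
        by_cases hi : i = a
        · subst hi
          simp [shiftedRows, haK]
        · simp [shiftedRows, hi]
      rw [h]
      exact ih K

/-- A P-matrix reverses the sign of no nonzero vector. -/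
theorem IsPMatrix.eq_zero_of_mul_mulVec_nonpos {M : Matrix ι ι ℝ} (hM : IsPMatrix M)
    {x : ι → ℝ} (hx : ∀ i, x i * (M *ᵥ x) i ≤ 0) : x = 0 := by
  set d : ι → ℝ := fun i => -((M *ᵥ x) i / x i) with hd
  have hd0 : ∀ i, 0 ≤ d i := by
    intro i
    have h : d i = -(x i * (M *ᵥ x) i / (x i * x i)) := by
      simp only [hd]
      field_simp
    rw [h, neg_nonneg]
    exact div_nonpos_of_nonpos_of_nonneg (hx i) (mul_self_nonneg _)
  have hpos := hM.det_shiftedRows_pos hd0 (Finset.univ.filter fun i => x i ≠ 0)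
  refine Matrix.eq_zero_of_mulVec_eq_zero hpos.ne' ?_
  funext i
  by_cases hi : x i = 0
  · simp [Matrix.mulVec, shiftedRows, hi]
  · have : (M i + d i • Pi.single i 1) ⬝ᵥ x = (M *ᵥ x) i + d i * x i := by
      simp [add_dotProduct, smul_dotProduct, Matrix.mulVec]
    simp only [Matrix.mulVec, shiftedRows, Finset.mem_filter, Finset.mem_univ, true_and, ne_eq,
      hi, not_false_eq_true, if_true, Pi.zero_apply]
    rw [this, hd]
    field_simp
    simp

/-- The LCP of a P-matrix has at most one solution. -/
theorem IsPMatrix.solvesLCP_unique {M : Matrix ι ι ℝ} (hM : IsPMatrix M) {q w z w' z' : ι → ℝ}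
    (h : SolvesLCP M q w z) (h' : SolvesLCP M q w' z') : z = z' := by
  obtain ⟨he, hw, hz, hwz⟩ := h
  obtain ⟨he', hw', hz', hwz'⟩ := h'
  have hc := (Finset.sum_eq_zero_iff_of_nonneg (fun i _ => mul_nonneg (hw i) (hz i))).1 hwz
  have hc' := (Finset.sum_eq_zero_iff_of_nonneg (fun i _ => mul_nonneg (hw' i) (hz' i))).1 hwz'
  refine sub_eq_zero.1 (hM.eq_zero_of_mul_mulVec_nonpos fun i => ?_)
  have h₁ := congrFun he i
  have h₂ := congrFun he' i
  have h₃ := hc i (Finset.mem_univ i)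
  have h₄ := hc' i (Finset.mem_univ i)
  simp only [Pi.sub_apply] at h₁ h₂
  rw [Matrix.mulVec_sub, Pi.sub_apply, Pi.sub_apply,
    show (M *ᵥ z) i - (M *ᵥ z') i = w i - w' i by linarith]
  nlinarith [mul_nonneg (hw i) (hz' i), mul_nonneg (hw' i) (hz i)]

theorem IsPMatrix.isUnit_det_basisMatrix {M : Matrix ι ι ℝ} (hM : IsPMatrix M) (B : Finset ι) :
    IsUnit (basisMatrix M B).det := by
  rw [isUnit_iff_ne_zero]
  intro h0
  obtain ⟨v, hv, hv0⟩ := Matrix.exists_mulVec_eq_zero_iff.2 h0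
  set z : ι → ℝ := fun i => if i ∈ B then v i else 0 with hz
  have hrow : ∀ i, (if i ∈ B then 0 else v i) = (M *ᵥ z) i := by
    intro i
    have h := congrFun hv0 i
    have : (basisMatrix M B *ᵥ v) i = (if i ∈ B then 0 else v i) - (M *ᵥ z) i := by
      have h1 : (if i ∈ B then 0 else v i) =
          ∑ j, if i = j then (if j ∈ B then 0 else v j) else 0 := by simp
      rw [h1]
      simp only [Matrix.mulVec, dotProduct, basisMatrix, hz]
      rw [← Finset.sum_sub_distrib]
      refine Finset.sum_congr rfl fun j _ => ?_
      split_ifs <;> simp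
    rw [this, Pi.zero_apply] at h
    linarith
  have hz0 : z = 0 := hM.eq_zero_of_mul_mulVec_nonpos fun i => by
    rw [← hrow i]
    by_cases hi : i ∈ B <;> simp [hz, hi]
  refine hv (funext fun i => ?_)
  by_cases hi : i ∈ B
  · simpa [hz, hi] using congrFun hz0 i
  · simpa [hz0, hi] using hrow i

/-- Principal subproblems of a nondegenerate LCP with a P-matrix are nondegenerate. -/
theorem Nondeg.submatrix {M : Matrix ι ι ℝ} {q : ι → ℝ} (hM : IsPMatrix M) (h : Nondeg M q)
    (e : κ ↪ ι) : Nondeg (M.submatrix e e) (q ∘ e) := by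
  intro B i
  set x := (basisMatrix M (B.map e))⁻¹ *ᵥ q with hx
  have hq : basisMatrix M (B.map e) *ᵥ x = q := by
    rw [hx, Matrix.mulVec_mulVec, Matrix.mul_nonsing_inv _ (hM.isUnit_det_basisMatrix _),
      Matrix.one_mulVec]
  have hsub : basisMatrix (M.submatrix e e) B *ᵥ (x ∘ e) = q ∘ e := by
    rw [← hq]
    funext a
    refine Fintype.sum_of_injective e e.injective _ _ (fun j hj => ?_) fun b => ?_
    · have h₁ : j ∉ B.map e := by
        rw [Finset.mem_map]
        rintro ⟨b, -, rfl⟩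
        exact hj ⟨b, rfl⟩
      have h₂ : e a ≠ j := fun hab => hj ⟨a, hab⟩
      simp [basisMatrix, h₁, h₂]
    · simp [basisMatrix]
  rw [← hsub, Matrix.mulVec_mulVec,
    Matrix.nonsing_inv_mul _ ((hM.submatrix e).isUnit_det_basisMatrix B), Matrix.one_mulVec]
  exact h (B.map e) (e i)

theorem Nondeg.zvec_ne_zero_iff {M : Matrix ι ι ℝ} {q : ι → ℝ} (h : Nondeg M q) (B : Finset ι)
    (i : ι) : zvec M q B i ≠ 0 ↔ i ∈ B := by
  by_cases hi : i ∈ B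
  · simp [zvec, hi, h B i]
  · simp [zvec, hi]

/-- If an optimal basis of an LCP does not influence the rows of a principal subproblem, then it
restricts to the optimal basis of that subproblem. -/
theorem OptimalBasis.mem_iff_of_submatrix {M : Matrix ι ι ℝ} {q : ι → ℝ} (hM : IsPMatrix M)
    (hnd : Nondeg M q) {B : Finset ι} (hB : OptimalBasis M q B) (e : κ ↪ ι) {C : Finset κ}
    (hC : OptimalBasis (M.submatrix e e) (q ∘ e) C)
    (he : ∀ i, ∀ j ∈ B, j ∉ Set.range e → M (e i) j = 0) (i : κ) : e i ∈ B ↔ i ∈ C := by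
  have hres := SolvesLCP.submatrix hB e fun a j hj => by
    by_cases hjB : j ∈ B
    · simp [he a j hjB hj]
    · simp [zvec, hjB]
  have hz := congrFun ((hM.submatrix e).solvesLCP_unique hres hC) i
  rw [← hnd.zvec_ne_zero_iff B, ← (hnd.submatrix hM e).zvec_ne_zero_iff C, ← hz]
  rfl

end PMatrix

/-- dynamic programming recurrence for upper Hessenberg
P-matrices, using lower-right principal subproblems. Here `Bf k hk ⊆ K_k`
(identified with a subset of `Fin k` via `lastEmb`) is the unique optimal basis
`B'(k)` of `LCP(M_{K_k K_k}, q_{K_k})`, and the paper's index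
`ℓ ∈ {-1, 0, …, k-1}` is encoded as `l = ℓ + 1 ∈ {0, …, k}` (so
`B'(-1) = B'(0) = ∅ = Bf 0`); the paper's 1-based set `{n-k+1, …, n-ℓ-1}`
consists, in the local 0-based coordinates of `K_k`, of the indices `i < k - l`. -/
theorem stmt_11 (n : ℕ) (M : Matrix (Fin n) (Fin n) ℝ) (q : Fin n → ℝ)
    (hM : IsPMatrix M) (hH : UpperHessenberg M) (hnd : Nondeg M q)
    (Bf : ∀ k : ℕ, k ≤ n → Finset (Fin k))
    (hBf : ∀ (k : ℕ) (hk : k ≤ n),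
      OptimalBasis (M.submatrix (lastEmb n k hk) (lastEmb n k hk))
        (fun j => q (lastEmb n k hk j)) (Bf k hk)) :
    ∀ (k : ℕ) (hk1 : 1 ≤ k) (hkn : k ≤ n),
      ∃ l : ℕ, ∃ hl : l ≤ k,
        Bf k hkn =
          (Bf (l - 1) (by omega)).image
              (fun j : Fin (l - 1) =>
                (⟨k - (l - 1) + j.val, by have := j.isLt; omega⟩ : Fin k)) ∪
            Finset.univ.filter (fun i : Fin k => (i : ℕ) < k - l) := by
  intro k hk1 hkn
  let e : Fin k ↪ Fin n := ⟨lastEmb n k hkn, fun a b hab => by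
    simp only [lastEmb, Fin.mk.injEq] at hab
    exact Fin.ext (by omega)⟩
  by_cases hall : ∃ m, ∃ hm : m < k, (⟨m, hm⟩ : Fin k) ∉ Bf k hkn
  · classical
    obtain ⟨hmk, hmB⟩ := Nat.find_spec hall
    have hmin : ∀ j (hj : j < k), j < Nat.find hall → (⟨j, hj⟩ : Fin k) ∈ Bf k hkn :=
      fun j hj hjm => by_contra fun hc => Nat.find_min hall hjm ⟨hj, hc⟩
    generalize Nat.find hall = m at hmk hmB hmin
    obtain ⟨r, rfl⟩ : ∃ r, k = m + 1 + r := ⟨k - (m + 1), by omega⟩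
    refine ⟨r + 1, by omega, ?_⟩
    let f : Fin r ↪ Fin (m + 1 + r) := Fin.natAddEmb (m + 1)
    have hval : ∀ a, (e a : ℕ) = n - (m + 1 + r) + a := fun _ => rfl
    have hfval : ∀ j, (f j : ℕ) = m + 1 + j := fun _ => rfl
    have hemb : ∀ j, e (f j) = lastEmb n r (by omega) j := by
      intro j
      apply Fin.ext
      rw [hval, hfval]
      simp only [lastEmb]
      omega
    have hC : OptimalBasis ((M.submatrix e e).submatrix f f) ((q ∘ e) ∘ f)
        (Bf r (by omega)) := by
      have h := hBf r (by omega)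
      have h₁ : (e ∘ f : Fin r → Fin n) = lastEmb n r (by omega) := funext hemb
      rwa [Matrix.submatrix_submatrix, Function.comp_assoc, h₁]
    have hmem := OptimalBasis.mem_iff_of_submatrix (hM.submatrix e) (hnd.submatrix hM e)
      (hBf _ hkn) f hC (by
        intro i j hjB hj
        have hjm : (j : ℕ) < m := by
          by_contra hc
          rcases Nat.eq_or_lt_of_not_lt hc with h | h
          · exact hmB (by convert hjB; exact h.symm)
          · exact hj ⟨⟨j - (m + 1), by omega⟩, Fin.ext (by simp [f]; omega)⟩
        apply hH
        rw [hval, hval, hfval]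
        omega)
    ext i
    simp only [Finset.mem_union, Finset.mem_image, Finset.mem_filter, Finset.mem_univ, true_and]
    rcases lt_trichotomy (i : ℕ) m with him | him | him
    · exact iff_of_true (hmin i i.2 him) (Or.inr (by omega))
    · refine iff_of_false (by convert hmB) ?_
      rintro (⟨j, -, rfl⟩ | h)
      · simp only at him
        omega
      · omega
    · obtain ⟨j, rfl⟩ : ∃ j, f j = i :=
        ⟨⟨i - (m + 1), by omega⟩, Fin.ext (by simp [f]; omega)⟩
      rw [hmem]
      constructor
      · exact fun hj => Or.inl ⟨j, hj, Fin.ext (by simp [f])⟩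
      · rintro (⟨j', hj', h⟩ | h)
        · have : j' = j := Fin.ext (by simpa [f] using congrArg Fin.val h)
          exact this ▸ hj'
        · omega
  · push Not at hall
    refine ⟨0, Nat.zero_le _, ?_⟩
    ext i
    simp [hall i i.2]
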